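/- If a finite sequence S admits two representations S = XYX = UVU, where Y is a nonempty proper suffix of X, V is a nonempty proper suffix of U, and X ≠ U, then CN(S) > 1. -/

import Mathlib

/-- `listPow Y k` is the sequence `Y` repeated `k` times (i.e. `Y^k`). -/
def listPow {α : Type*} (Y : List α) : ℕ → List α
  | 0 => []
  | k + 1 => Y ++ listPow Y k

/-- The curling number of a finite sequence `S`: the largest `k` such that
`S = X ++ Y^k` for some (possibly empty) `X` and nonempty `Y`. -/
noncomputable def CN {α : Type*} (S : List α) : ℕ :=
  sSup {k | ∃ X Y : List α, Y ≠ [] ∧ S = X ++ listPow Y k}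

/-- A nonempty sequence is primitive if it is not a power `T^i` with `i ≥ 2`. -/
def Primitive {α : Type*} (S : List α) : Prop :=
  S ≠ [] ∧ ∀ (T : List α) (i : ℕ), 2 ≤ i → S ≠ listPow T i

/-- `T` is a proper suffix of `S`: a suffix which is strictly shorter than `S`. -/
def ProperSuffix {α : Type*} (T S : List α) : Prop := T <:+ S ∧ T.length < S.length

/-- A sequence `S` with curling number `k` is robust if no proper suffix of
`S^(k+1)` has curling number `≥ k + 1`. -/
def Robust {α : Type*} (S : List α) : Prop :=
  ∀ T : List α, ProperSuffix T (listPow S (CN S + 1)) → CN T ≤ CN S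

theorem length_listPow {α : Type*} (Y : List α) (k : ℕ) :
    (listPow Y k).length = k * Y.length := by
  induction k with
  | zero => simp [listPow]
  | succ k ih => simp [listPow, ih]; ring

theorem bddAbove_setOf_eq_append_listPow {α : Type*} (S : List α) :
    BddAbove {k | ∃ X Y : List α, Y ≠ [] ∧ S = X ++ listPow Y k} := by
  refine ⟨S.length, ?_⟩
  rintro k ⟨X, Y, hY, rfl⟩
  have hY := List.length_pos_iff.mpr hY
  rw [List.length_append, length_listPow]
  nlinarith

theorem one_lt_CN_of_square_suffix {α : Type*} {S W : List α} (hW : W ≠ [])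
    (h : W ++ W <:+ S) : 1 < CN S := by
  obtain ⟨Q, rfl⟩ := h
  exact le_csSup (bddAbove_setOf_eq_append_listPow _) ⟨Q, W, hW, by simp [listPow]⟩

/-- A border of at least half the length of a sequence forces a square suffix. -/
theorem exists_square_suffix_of_long_border {α : Type*} {X U : List α}
    (hpre : X <+: U) (hsuf : X <:+ U) (hlt : X.length < U.length)
    (hle : U.length ≤ 2 * X.length) : ∃ W, W ≠ [] ∧ W ++ W <:+ U := by
  obtain ⟨W, rfl⟩ := hpre
  rw [List.length_append] at hlt hle
  obtain ⟨Q, rfl⟩ : W <:+ X :=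
    List.suffix_of_suffix_length_le (List.suffix_append X W) hsuf (by omega)
  exact ⟨W, List.length_pos_iff.mp (by omega), Q, by simp⟩

theorem one_lt_CN_of_two_borders {α : Type*} {S X U : List α}
    (hXp : X <+: S) (hXs : X <:+ S) (hUp : U <+: S) (hUs : U <:+ S)
    (hlt : X.length < U.length) (hle : U.length ≤ 2 * X.length) : 1 < CN S := by
  obtain ⟨W, hW, hWU⟩ := exists_square_suffix_of_long_border
    (List.prefix_of_prefix_length_le hXp hUp hlt.le)
    (List.suffix_of_suffix_length_le hXs hUs hlt.le) hlt hle
  exact one_lt_CN_of_square_suffix hW (hWU.trans hUs)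

/-- If `S = X Y X = U V U` with `Y` a nonempty proper suffix of `X`, `V` a nonempty
proper suffix of `U`, and `X ≠ U`, then `CN S > 1`. -/
theorem two_representations_CN_gt_one {α : Type*} (S X Y U V : List α)
    (h1 : S = X ++ Y ++ X) (h2 : S = U ++ V ++ U)
    (hY : Y ≠ []) (hYX : ProperSuffix Y X)
    (hV : V ≠ []) (hVU : ProperSuffix V U)
    (hXU : X ≠ U) :
    1 < CN S := by
  have hXp : X <+: S := ⟨Y ++ X, by simp [h1]⟩
  have hXs : X <:+ S := ⟨X ++ Y, h1.symm⟩
  have hUp : U <+: S := ⟨V ++ U, by simp [h2]⟩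
  have hUs : U <:+ S := ⟨U ++ V, h2.symm⟩
  have hlen : (X ++ Y ++ X).length = (U ++ V ++ U).length := by rw [← h1, ← h2]
  simp only [List.length_append] at hlen
  have hYX := hYX.2
  have hVU := hVU.2
  rcases lt_trichotomy X.length U.length with h | h | h
  · exact one_lt_CN_of_two_borders hXp hXs hUp hUs h (by omega)
  · exact absurd ((List.prefix_of_prefix_length_le hXp hUp h.le).eq_of_length h) hXU
  · exact one_lt_CN_of_two_borders hUp hUs hXp hXs h (by omega)
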